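/- Let A_1, …, A_m be irreducible nonnegative n×n matrices that pairwise commute with respect to the max-algebraic matrix product: A_i ⊗ A_j = A_j ⊗ A_i for all 1 ≤ i, j ≤ m. Then there exists a positive vector x ∈ int(ℝ^n_+) with A_i⊗x = μ(A_i)·x for all i = 1,…,m. -/

import Mathlib

open Filter Relation

namespace MaxAlg

/-- Max-algebraic action of a matrix on a vector: `(A ⊗ x) i = max_j A i j * x j`. -/
noncomputable def maxVec {n : ℕ} (A : Fin n → Fin n → ℝ) (x : Fin n → ℝ) : Fin n → ℝ :=
  fun i => ⨆ j, A i j * x j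

/-- Max-algebraic matrix product: `(A ⊗ B) i k = max_j A i j * B j k`. -/
noncomputable def maxMul {n : ℕ} (A B : Fin n → Fin n → ℝ) : Fin n → Fin n → ℝ :=
  fun i k => ⨆ j, A i j * B j k

/-- The weight of the cycle determined by a list `[i₁, …, i_k]`,
namely `A i₁ i₂ * ⋯ * A i_{k-1} i_k * A i_k i₁`. -/
noncomputable def cycleProd {n : ℕ} (A : Fin n → Fin n → ℝ) (l : List (Fin n)) : ℝ :=
  ((l.zip (l.rotate 1)).map fun p => A p.1 p.2).prod

/-- The maximal cycle geometric mean of `A`: the supremum over all cycles of distinct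
nodes of the k-th root of the cycle weight. -/
noncomputable def mu {n : ℕ} (A : Fin n → Fin n → ℝ) : ℝ :=
  sSup {c | ∃ l : List (Fin n), l ≠ [] ∧ l.Nodup ∧ c = cycleProd A l ^ ((l.length : ℝ)⁻¹)}

/-- `C_{A,r}`: the positive vectors with `A ⊗ x ≤ r x`. -/
def Cset {n : ℕ} (A : Fin n → Fin n → ℝ) (r : ℝ) : Set (Fin n → ℝ) :=
  {x | (∀ i, 0 < x i) ∧ ∀ i, maxVec A x i ≤ r * x i}

/-- A critical cycle: a cycle of distinct nodes attaining `mu A`. -/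
def IsCriticalCycle {n : ℕ} (A : Fin n → Fin n → ℝ) (l : List (Fin n)) : Prop :=
  l ≠ [] ∧ l.Nodup ∧ cycleProd A l ^ ((l.length : ℝ)⁻¹) = mu A

/-- `(i,j) ∈ E^C(A)`: the edge `(i,j)` lies on some critical cycle. -/
def criticalEdge {n : ℕ} (A : Fin n → Fin n → ℝ) (i j : Fin n) : Prop :=
  ∃ l : List (Fin n), IsCriticalCycle A l ∧ (i, j) ∈ l.zip (l.rotate 1)

/-- `i ∈ N^C(A)`: the node `i` lies on some critical cycle. -/
def criticalNode {n : ℕ} (A : Fin n → Fin n → ℝ) (i : Fin n) : Prop :=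
  ∃ l : List (Fin n), IsCriticalCycle A l ∧ i ∈ l

/-- Irreducibility: the digraph of `A` (edge `(i,j)` iff `A i j > 0`) is strongly connected. -/
def Irred {n : ℕ} (A : Fin n → Fin n → ℝ) : Prop :=
  ∀ i j, Relation.ReflTransGen (fun a b => 0 < A a b) i j

/-- Max-algebraic product of a word of matrices from the family `A`. -/
noncomputable def wordProd {n m : ℕ} (A : Fin m → Fin n → Fin n → ℝ) :
    List (Fin m) → (Fin n → Fin n → ℝ)
  | [] => fun i j => if i = j then 1 else 0
  | [j] => A j
  | j :: k :: w => maxMul (A j) (wordProd A (k :: w))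

/-- The max version of the generalised spectral radius
`μ̂(Ψ) = limsup_{p→∞} (max_{ψ ∈ Ψ^p_⊗} μ(ψ))^{1/p}`. -/
noncomputable def genSpecRad {n m : ℕ} (A : Fin m → Fin n → Fin n → ℝ) : ℝ :=
  Filter.limsup
    (fun p : ℕ =>
      (sSup {c | ∃ w : List (Fin m), w.length = p ∧ c = mu (wordProd A w)}) ^ ((p : ℝ)⁻¹))
    Filter.atTop

/-- `S = A₁ ⊕ ⋯ ⊕ A_m`: the entrywise maximum of the family. -/
noncomputable def Smat {n m : ℕ} (A : Fin m → Fin n → Fin n → ℝ) : Fin n → Fin n → ℝ :=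
  fun i j => ⨆ k, A k i j

/-- The relative error function `e_A(x) = max_{i,j} A i j * x j / x i`. -/
noncomputable def errF {n : ℕ} (A : Fin n → Fin n → ℝ) (x : Fin n → ℝ) : ℝ :=
  ⨆ i, ⨆ j, A i j * x j / x i

/-- A symmetrically reciprocal (SR) matrix: positive, with unit diagonal and
`A i j * A j i = 1` for `i ≠ j`. -/
def IsSR {n : ℕ} (A : Fin n → Fin n → ℝ) : Prop :=
  (∀ i j, 0 < A i j) ∧ (∀ i, A i i = 1) ∧ ∀ i j, i ≠ j → A i j * A j i = 1

/-- Max-algebraic matrix powers. -/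
noncomputable def maxPow {n : ℕ} (B : Fin n → Fin n → ℝ) : ℕ → (Fin n → Fin n → ℝ)
  | 0 => fun i j => if i = j then 1 else 0
  | p + 1 => maxMul B (maxPow B p)

/-- The Kleene star `B* = I ⊕ B ⊕ B⊗² ⊕ ⋯ ⊕ B⊗^{n-1}`. -/
noncomputable def kleeneStar {n : ℕ} (B : Fin n → Fin n → ℝ) : Fin n → Fin n → ℝ :=
  fun i j => ⨆ p : Fin n, maxPow B p i j

section maxVec

variable {n : ℕ} {A B : Fin n → Fin n → ℝ} {x y : Fin n → ℝ}

theorem mul_le_maxVec (A : Fin n → Fin n → ℝ) (x : Fin n → ℝ) (i j : Fin n) :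
    A i j * x j ≤ maxVec A x i :=
  le_ciSup (f := fun j => A i j * x j) (Set.finite_range _).bddAbove j

theorem maxVec_le_iff [NeZero n] {c : ℝ} {i : Fin n} :
    maxVec A x i ≤ c ↔ ∀ j, A i j * x j ≤ c :=
  ciSup_le_iff (Set.finite_range _).bddAbove

theorem exists_maxVec_eq [NeZero n] (A : Fin n → Fin n → ℝ) (x : Fin n → ℝ) (i : Fin n) :
    ∃ j, A i j * x j = maxVec A x i :=
  exists_eq_ciSup_of_finite

theorem maxVec_nonneg (hA : ∀ i j, 0 ≤ A i j) (hx : 0 ≤ x) : 0 ≤ maxVec A x :=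
  fun i => Real.iSup_nonneg fun j => mul_nonneg (hA i j) (hx j)

theorem maxVec_mono [NeZero n] (hA : ∀ i j, 0 ≤ A i j) : Monotone (maxVec A) :=
  fun _ y hxy i => maxVec_le_iff.2 fun j =>
    (mul_le_mul_of_nonneg_left (hxy j) (hA i j)).trans (mul_le_maxVec A y i j)

theorem maxVec_smul (A : Fin n → Fin n → ℝ) {c : ℝ} (hc : 0 ≤ c) (x : Fin n → ℝ) :
    maxVec A (c • x) = c • maxVec A x := by
  ext i
  simp only [maxVec, Pi.smul_apply, smul_eq_mul, Real.mul_iSup_of_nonneg hc]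
  exact iSup_congr fun j => by ring

theorem maxVec_sup [NeZero n] (hA : ∀ i j, 0 ≤ A i j) (x y : Fin n → ℝ) :
    maxVec A (x ⊔ y) = maxVec A x ⊔ maxVec A y := by
  refine le_antisymm (fun i => maxVec_le_iff.2 fun j => ?_)
    (sup_le (maxVec_mono hA le_sup_left) (maxVec_mono hA le_sup_right))
  rw [Pi.sup_apply, Pi.sup_apply, mul_max_of_nonneg _ _ (hA i j)]
  exact max_le_max (mul_le_maxVec A x i j) (mul_le_maxVec A y i j)

theorem maxVec_maxVec [NeZero n] (hA : ∀ i j, 0 ≤ A i j) (hx : 0 ≤ x) :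
    maxVec A (maxVec B x) = maxVec (maxMul A B) x := by
  ext i
  apply le_antisymm
  · refine maxVec_le_iff.2 fun j => ?_
    obtain ⟨k, hk⟩ := exists_maxVec_eq B x j
    rw [← hk, ← mul_assoc]
    refine le_trans ?_ (mul_le_maxVec (maxMul A B) x i k)
    exact mul_le_mul_of_nonneg_right
      (le_ciSup (f := fun j => A i j * B j k) (Set.finite_range _).bddAbove j) (hx k)
  · refine maxVec_le_iff.2 fun k => ?_
    obtain ⟨j, hj⟩ : ∃ j, A i j * B j k = maxMul A B i k := exists_eq_ciSup_of_finite
    rw [← hj, mul_assoc]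
    exact (mul_le_mul_of_nonneg_left (mul_le_maxVec B x j k) (hA i j)).trans
      (mul_le_maxVec A _ i j)

theorem continuous_maxVec [NeZero n] (A : Fin n → Fin n → ℝ) : Continuous (maxVec A) := by
  refine continuous_pi fun i => ?_
  simp only [maxVec, ← Finset.sup'_univ_eq_ciSup]
  exact Continuous.finset_sup'_apply _ fun j _ => by fun_prop

end maxVec

section cycles

variable {n : ℕ} {A : Fin n → Fin n → ℝ} {x : Fin n → ℝ} {r : ℝ}

theorem cycleProd_nonneg (hA : ∀ i j, 0 ≤ A i j) (l : List (Fin n)) : 0 ≤ cycleProd A l :=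
  List.prod_nonneg fun a ha => by
    obtain ⟨p, -, rfl⟩ := List.mem_map.1 ha
    exact hA p.1 p.2

theorem mu_nonneg (hA : ∀ i j, 0 ≤ A i j) : 0 ≤ mu A := by
  refine Real.sSup_nonneg ?_
  rintro c ⟨l, -, -, rfl⟩
  exact Real.rpow_nonneg (cycleProd_nonneg hA l) _

theorem prod_map_snd_zip_rotate (x : Fin n → ℝ) (l : List (Fin n)) :
    ((l.zip (l.rotate 1)).map fun p => x p.2).prod = (l.map x).prod := by
  have h : ((l.zip (l.rotate 1)).map fun p => x p.2) = (l.rotate 1).map x := by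
    rw [← Function.comp_def x Prod.snd, ← List.map_map, List.map_snd_zip (by simp)]
  rw [h, ((l.rotate_perm 1).map x).prod_eq]

theorem prod_map_mul_fst_zip_rotate (x : Fin n → ℝ) (r : ℝ) (l : List (Fin n)) :
    ((l.zip (l.rotate 1)).map fun p => r * x p.1).prod = r ^ l.length * (l.map x).prod := by
  have h : ((l.zip (l.rotate 1)).map fun p => r * x p.1) = l.map fun i => r * x i := by
    rw [← Function.comp_def (fun i => r * x i) Prod.fst, ← List.map_map, List.map_fst_zip (by simp)]
  rw [h, List.prod_map_mul, List.map_const', List.prod_replicate]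

theorem cycleProd_le_pow (hA : ∀ i j, 0 ≤ A i j) (hx : ∀ i, 0 < x i)
    (h : ∀ i j, A i j * x j ≤ r * x i) (l : List (Fin n)) :
    cycleProd A l ≤ r ^ l.length := by
  have hpos : 0 < (l.map x).prod := List.prod_pos fun a ha => by
    obtain ⟨i, -, rfl⟩ := List.mem_map.1 ha
    exact hx i
  refine le_of_mul_le_mul_right ?_ hpos
  rw [← prod_map_mul_fst_zip_rotate, ← prod_map_snd_zip_rotate, cycleProd, ← List.prod_map_mul]
  exact List.prod_map_le_prod_map₀ _ _ (fun p _ => mul_nonneg (hA _ _) (hx _).le)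
    fun p _ => h _ _

theorem cycleProd_eq_pow (hx : ∀ i, 0 < x i) {l : List (Fin n)}
    (h : ∀ p ∈ l.zip (l.rotate 1), A p.1 p.2 * x p.2 = r * x p.1) :
    cycleProd A l = r ^ l.length := by
  have hpos : 0 < (l.map x).prod := List.prod_pos fun a ha => by
    obtain ⟨i, -, rfl⟩ := List.mem_map.1 ha
    exact hx i
  refine mul_right_cancel₀ hpos.ne' ?_
  rw [← prod_map_mul_fst_zip_rotate, ← prod_map_snd_zip_rotate, cycleProd, ← List.prod_map_mul]
  exact congrArg List.prod (List.map_congr_left h)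

/-- Every self-map of a nonempty finite type has a cycle of distinct points. -/
theorem exists_nodup_rotate_eq_map {α : Type*} [Finite α] [Nonempty α] (g : α → α) :
    ∃ l : List α, l ≠ [] ∧ l.Nodup ∧ l.rotate 1 = l.map g := by
  obtain ⟨a, ha⟩ : ∃ a, a ∈ Function.periodicPts g := by
    obtain ⟨a₀⟩ := ‹Nonempty α›
    obtain ⟨p, q, hne, hpq⟩ := Finite.exists_ne_map_eq_of_infinite fun k : ℕ => g^[k] a₀
    wlog hlt : p < q generalizing p q
    · exact this q p hne.symm hpq.symm (by omega)
    refine ⟨g^[p] a₀, Function.mk_mem_periodicPts (Nat.sub_pos_of_lt hlt) ?_⟩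
    rw [Function.IsPeriodicPt, Function.IsFixedPt, ← Function.iterate_add_apply,
      Nat.sub_add_cancel hlt.le]
    exact hpq.symm
  have hpos := Function.minimalPeriod_pos_of_mem_periodicPts ha
  refine ⟨(List.range (Function.minimalPeriod g a)).map fun k => g^[k] a, ?_, ?_, ?_⟩
  · simpa using hpos.ne'
  · exact Cycle.nodup_coe_iff.1 (Function.nodup_periodicOrbit (f := g) (x := a))
  · refine List.ext_getElem (by simp) fun i h₁ h₂ => ?_
    simp only [List.getElem_rotate, List.getElem_map, List.getElem_range, List.length_map,
      List.length_range, Function.iterate_mod_minimalPeriod_eq, Function.iterate_succ_apply']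

/-- The only eigenvalue with a positive eigenvector is the maximal cycle geometric mean. -/
theorem mu_eq_of_maxVec_eq_smul [NeZero n] (hA : ∀ i j, 0 ≤ A i j) (hx : ∀ i, 0 < x i)
    (hr : 0 ≤ r) (h : maxVec A x = r • x) : mu A = r := by
  have h' : ∀ i, maxVec A x i = r * x i := fun i => congrFun h i
  refine IsGreatest.csSup_eq ⟨?_, ?_⟩
  · choose g hg using exists_maxVec_eq A x
    obtain ⟨l, hl, hnd, hrot⟩ := exists_nodup_rotate_eq_map g
    refine ⟨l, hl, hnd, ?_⟩
    rw [cycleProd_eq_pow (r := r) hx, Real.pow_rpow_inv_natCast hr (by simpa using hl)]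
    intro p hp
    have hzip : l.zip (l.map g) = l.map fun i => (i, g i) := by
      simpa using List.zip_map' (f := id) (g := g) (l := l)
    rw [hrot, hzip] at hp
    obtain ⟨i, -, rfl⟩ := List.mem_map.1 hp
    exact (hg i).trans (h' i)
  · rintro c ⟨l, hl, -, rfl⟩
    have hle := cycleProd_le_pow hA hx (fun i j => (mul_le_maxVec A x i j).trans_eq (h' i)) l
    calc cycleProd A l ^ ((l.length : ℝ)⁻¹)
        ≤ (r ^ l.length) ^ ((l.length : ℝ)⁻¹) :=
          Real.rpow_le_rpow (cycleProd_nonneg hA l) hle (by positivity)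
      _ = r := Real.pow_rpow_inv_natCast hr (by simpa using hl)

end cycles

section eigenvector

variable {n : ℕ} {B : Fin n → Fin n → ℝ} {x y : Fin n → ℝ} {r : ℝ}

theorem pos_of_irred (hirr : Irred B) (hr : 0 ≤ r)
    (h : maxVec B x ≤ r • x) {i : Fin n} (hi : 0 < x i) (j : Fin n) : 0 < x j := by
  refine ReflTransGen.head_induction_on (motive := fun a _ => 0 < x a) (hirr j i) hi ?_
  intro a b hab _ hb
  have h₁ : 0 < r * x a := (mul_pos hab hb).trans_le ((mul_le_maxVec B x a b).trans (h a))
  exact pos_of_mul_pos_right h₁ hr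

/-- If the max-linear map of `B` eventually contracts a vector `y` by a factor `t ^ p`, then some
maximum of rescaled iterates of `y` is contracted by the factor `t` in one step. -/
theorem exists_maxVec_le_smul [NeZero n] (hB : ∀ i j, 0 ≤ B i j) {V : Set (Fin n → ℝ)}
    (hsup : ∀ x ∈ V, ∀ y ∈ V, x ⊔ y ∈ V) (hsmul : ∀ c : ℝ, 0 ≤ c → ∀ x ∈ V, c • x ∈ V)
    (hBV : ∀ x ∈ V, maxVec B x ∈ V) (hy : y ∈ V) {t : ℝ} (ht : 0 < t) {p : ℕ}
    (hp : (maxVec B)^[p + 1] y ≤ t ^ (p + 1) • y) :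
    ∃ w ∈ V, y ≤ w ∧ maxVec B w ≤ t • w := by
  set u : ℕ → Fin n → ℝ := fun q => (t⁻¹) ^ q • (maxVec B)^[q] y with hu
  have hstep : ∀ q, maxVec B (u q) = t • u (q + 1) := fun q => by
    simp only [hu]
    rw [maxVec_smul B (by positivity), Function.iterate_succ_apply', smul_smul, pow_succ',
      mul_inv_cancel_left₀ ht.ne']
  have hiter : ∀ q, (maxVec B)^[q] y ∈ V := fun q => by
    induction q with
    | zero => exact hy
    | succ q ih => rw [Function.iterate_succ_apply']; exact hBV _ ih
  have hmem : ∀ q, partialSups u q ∈ V := fun q => by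
    induction q with
    | zero => rw [partialSups_zero]; exact hsmul _ (by positivity) _ (hiter 0)
    | succ q ih =>
      rw [partialSups_add_one]
      exact hsup _ ih _ (hsmul _ (by positivity) _ (hiter _))
  have hle : ∀ q, maxVec B (partialSups u q) ≤ t • partialSups u (q + 1) := fun q => by
    induction q with
    | zero =>
      rw [partialSups_zero, hstep]
      exact smul_le_smul_of_nonneg_left (le_partialSups u 1) ht.le
    | succ q ih =>
      rw [partialSups_add_one u q, maxVec_sup hB, hstep]
      refine sup_le (ih.trans ?_) ?_
      · exact smul_le_smul_of_nonneg_left ((partialSups u).monotone (Nat.le_succ _)) ht.le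
      · exact smul_le_smul_of_nonneg_left (le_partialSups u (q + 2)) ht.le
  have h0 : u 0 = y := by simp [hu]
  have hy_le : y ≤ partialSups u p := h0 ▸ le_partialSups_of_le u (Nat.zero_le p)
  have hlast : u (p + 1) ≤ y := by
    calc u (p + 1) ≤ (t⁻¹) ^ (p + 1) • t ^ (p + 1) • y :=
          smul_le_smul_of_nonneg_left hp (by positivity)
      _ = y := by rw [smul_smul, ← mul_pow, inv_mul_cancel₀ ht.ne', one_pow, one_smul]
  refine ⟨partialSups u p, hmem p, hy_le, (hle p).trans ?_⟩
  rw [partialSups_add_one, sup_eq_left.2 (hlast.trans hy_le)]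

/-- Inside a closed max-cone invariant under an irreducible `B`, the smallest `r` admitting a
vector with `B ⊗ x ≤ r x` is attained. -/
theorem exists_minimal_subeigenvector [NeZero n] (hB : ∀ i j, 0 ≤ B i j) (hirr : Irred B)
    {V : Set (Fin n → ℝ)} (hclosed : IsClosed V)
    (hsmul : ∀ c : ℝ, 0 ≤ c → ∀ x ∈ V, c • x ∈ V) (hx : x ∈ V) (hpos : ∀ i, 0 < x i) :
    ∃ y ∈ V, ∃ r : ℝ, 0 ≤ r ∧ (∀ i, 0 < y i) ∧ maxVec B y ≤ r • y ∧
      ∀ w ∈ V, (∀ i, 0 < w i) → ∀ s : ℝ, 0 ≤ s → maxVec B w ≤ s • w → r ≤ s := by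
  have hnormalize : ∀ w ∈ V, (∀ i, 0 < w i) → ∀ s : ℝ, maxVec B w ≤ s • w →
      ∃ v ∈ V, v ∈ stdSimplex ℝ (Fin n) ∧ maxVec B v ≤ s • v := by
    intro w hw hwpos s hs
    have hsum : 0 < ∑ i, w i := Finset.sum_pos (fun i _ => hwpos i) Finset.univ_nonempty
    have hinv : 0 ≤ (∑ i, w i)⁻¹ := (inv_pos.2 hsum).le
    refine ⟨(∑ i, w i)⁻¹ • w, hsmul _ hinv _ hw, ⟨fun i => mul_nonneg hinv (hwpos i).le, ?_⟩, ?_⟩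
    · simp only [Pi.smul_apply, smul_eq_mul, ← Finset.mul_sum]
      exact inv_mul_cancel₀ hsum.ne'
    · rw [maxVec_smul B hinv, smul_comm]
      exact smul_le_smul_of_nonneg_left hs hinv
  obtain ⟨R, hR0, hR⟩ : ∃ R : ℝ, 0 ≤ R ∧ maxVec B x ≤ R • x := by
    obtain ⟨R, hR⟩ := (Set.finite_range fun i => maxVec B x i / x i).bddAbove
    have hR' : ∀ i, maxVec B x i / x i ≤ R := fun i => hR ⟨i, rfl⟩
    refine ⟨R, ?_, fun i => (div_le_iff₀ (hpos i)).1 (hR' i)⟩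
    exact (div_nonneg (maxVec_nonneg hB (fun i => (hpos i).le) 0) (hpos 0).le).trans (hR' 0)
  set K : Set ((Fin n → ℝ) × ℝ) :=
    (stdSimplex ℝ (Fin n) ×ˢ Set.Icc 0 R) ∩ {q | q.1 ∈ V ∧ maxVec B q.1 ≤ q.2 • q.1} with hK
  have hKc : IsCompact K := by
    refine ((isCompact_stdSimplex ℝ (Fin n)).prod isCompact_Icc).inter_right ?_
    refine (hclosed.preimage continuous_fst).inter
      (isClosed_le (f := fun q : (Fin n → ℝ) × ℝ => maxVec B q.1) (g := fun q => q.2 • q.1) ?_ ?_)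
    · exact (continuous_maxVec B).comp continuous_fst
    · exact continuous_snd.smul continuous_fst
  have hKne : K.Nonempty := by
    obtain ⟨v, hv, hvs, hvR⟩ := hnormalize x hx hpos R hR
    exact ⟨(v, R), ⟨hvs, hR0, le_rfl⟩, hv, hvR⟩
  obtain ⟨⟨y, r⟩, ⟨⟨hys, hr0, hrR⟩, hyV, hyr⟩, hmin⟩ :=
    hKc.exists_isMinOn hKne continuous_snd.continuousOn
  dsimp only at hys hr0 hrR hyV hyr
  obtain ⟨i, hi⟩ : ∃ i, 0 < y i := by
    by_contra! h
    have := Finset.sum_nonpos fun i (_ : i ∈ Finset.univ) => h i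
    linarith [hys.2]
  refine ⟨y, hyV, r, hr0, pos_of_irred hirr hr0 hyr hi, hyr, ?_⟩
  intro w hw hwpos s hs hws
  rcases le_total s R with hsR | hRs
  · obtain ⟨v, hv, hvs, hvs'⟩ := hnormalize w hw hwpos s hws
    exact hmin (a := (v, s)) ⟨⟨hvs, hs, hsR⟩, hv, hvs'⟩
  · exact hrR.trans hRs

/-- A closed max-cone invariant under an irreducible `B` and containing a positive vector contains
a positive eigenvector of `B`. -/
theorem exists_pos_eigenvector_mem [NeZero n] (hB : ∀ i j, 0 ≤ B i j) (hirr : Irred B)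
    {V : Set (Fin n → ℝ)} (hclosed : IsClosed V)
    (hsup : ∀ x ∈ V, ∀ y ∈ V, x ⊔ y ∈ V) (hsmul : ∀ c : ℝ, 0 ≤ c → ∀ x ∈ V, c • x ∈ V)
    (hBV : ∀ x ∈ V, maxVec B x ∈ V) (hx : x ∈ V) (hpos : ∀ i, 0 < x i) :
    ∃ z ∈ V, ∃ r : ℝ, 0 ≤ r ∧ (∀ i, 0 < z i) ∧ maxVec B z = r • z := by
  obtain ⟨y, hy, r, hr, hypos, hyr, hmin⟩ :=
    exists_minimal_subeigenvector hB hirr hclosed hsmul hx hpos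
  have hy0 : 0 ≤ y := fun i => (hypos i).le
  rcases hr.eq_or_lt with rfl | hr
  · refine ⟨y, hy, 0, le_rfl, hypos, le_antisymm hyr ?_⟩
    rw [zero_smul]
    exact maxVec_nonneg hB hy0
  set f : (Fin n → ℝ) → Fin n → ℝ := fun v => r⁻¹ • maxVec B v with hf
  have hri : 0 ≤ r⁻¹ := (inv_pos.2 hr).le
  have hfmono : Monotone f := fun v w hvw => smul_le_smul_of_nonneg_left (maxVec_mono hB hvw) hri
  have hfy : f y ≤ y := by
    have := smul_le_smul_of_nonneg_left hyr hri
    rwa [smul_smul, inv_mul_cancel₀ hr.ne', one_smul] at this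
  have hanti : Antitone fun q => f^[q] y := hfmono.antitone_iterate_of_map_le hfy
  have hiter : ∀ q, f^[q] y ∈ V ∧ 0 ≤ f^[q] y ∧ (maxVec B)^[q] y = r ^ q • f^[q] y := fun q => by
    induction q with
    | zero => simpa using ⟨hy, hy0⟩
    | succ q ih =>
      rw [Function.iterate_succ_apply', Function.iterate_succ_apply']
      refine ⟨hsmul _ hri _ (hBV _ ih.1), smul_nonneg hri (maxVec_nonneg hB ih.2.1), ?_⟩
      rw [ih.2.2, maxVec_smul B (by positivity), hf, smul_smul, pow_succ, mul_assoc,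
        mul_inv_cancel₀ hr.ne', mul_one]
  obtain ⟨z, hz⟩ : ∃ z, Tendsto (fun q => f^[q] y) atTop (nhds z) :=
    ⟨_, tendsto_pi_nhds.2 fun i => tendsto_atTop_ciInf (fun a b hab => hanti hab i)
      ⟨0, by rintro _ ⟨q, rfl⟩; exact (hiter q).2.1 i⟩⟩
  have hzV : z ∈ V := hclosed.mem_of_tendsto hz (Eventually.of_forall fun q => (hiter q).1)
  have hfz : maxVec B z = r • z := by
    have hfix : f z = z := isFixedPt_of_tendsto_iterate hz
      ((continuous_maxVec B).const_smul r⁻¹).continuousAt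
    calc maxVec B z = r • f z := by rw [hf, smul_smul, mul_inv_cancel₀ hr.ne', one_smul]
      _ = r • z := by rw [hfix]
  refine ⟨z, hzV, r, hr.le, ?_, hfz⟩
  by_cases hne : ∃ i, 0 < z i
  · obtain ⟨i, hi⟩ := hne
    exact pos_of_irred hirr hr.le hfz.le hi
  exfalso
  push Not at hne
  obtain ⟨p, hp⟩ : ∃ p, ∀ i, f^[p + 1] y i ≤ 1 / 2 * y i := by
    have hev : ∀ᶠ q in atTop, ∀ i, f^[q] y i ≤ 1 / 2 * y i := by
      refine eventually_all.2 fun i => (tendsto_pi_nhds.1 hz i).eventually_le_const ?_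
      linarith [hne i, hypos i]
    exact ((tendsto_add_atTop_nat 1).eventually hev).exists
  set t : ℝ := 1 - 1 / (2 * (p + 1)) with ht
  have hfrac : 0 < 1 / (2 * ((p : ℝ) + 1)) ∧ 1 / (2 * ((p : ℝ) + 1)) ≤ 1 / 2 := by
    refine ⟨by positivity, one_div_le_one_div_of_le (by norm_num) ?_⟩
    linarith [(Nat.cast_nonneg p : (0 : ℝ) ≤ p)]
  have ht0 : 0 < t := by linarith [hfrac.2]
  have ht1 : t < 1 := by linarith [hfrac.1]
  have htp : 1 / 2 ≤ t ^ (p + 1) := by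
    have hbern := one_add_mul_le_pow (a := -(1 / (2 * ((p : ℝ) + 1)))) (by linarith [hfrac.2])
      (p + 1)
    rw [← sub_eq_add_neg] at hbern
    refine le_trans (le_of_eq ?_) hbern
    have : (p : ℝ) + 1 ≠ 0 := by positivity
    push_cast
    field_simp
    norm_num
  obtain ⟨w, hwV, hyw, hw⟩ := exists_maxVec_le_smul hB hsup hsmul hBV hy (t := r * t) (p := p)
    (by positivity) (by
      rw [(hiter _).2.2, mul_pow, mul_smul]
      refine smul_le_smul_of_nonneg_left (fun i => (hp i).trans ?_) (by positivity)
      exact mul_le_mul_of_nonneg_right htp (hypos i).le)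
  have := hmin w hwV (fun i => (hypos i).trans_le (hyw i)) _ (by positivity) hw
  nlinarith

end eigenvector

/-- pairwise max-algebraically commuting irreducible nonnegative matrices
have a common positive max eigenvector. -/
theorem stmt9 {n m : ℕ} (hm : 0 < m) (A : Fin m → Fin n → Fin n → ℝ)
    (hA : ∀ k i j, 0 ≤ A k i j) (hirr : ∀ k, Irred (A k))
    (hcomm : ∀ k l, maxMul (A k) (A l) = maxMul (A l) (A k)) :
    ∃ x : Fin n → ℝ, (∀ i, 0 < x i) ∧ ∀ k i, maxVec (A k) x i = mu (A k) * x i := by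
  rcases Nat.eq_zero_or_pos n with rfl | hn
  · exact ⟨0, fun i => i.elim0, fun _ i => i.elim0⟩
  have : NeZero n := ⟨hn.ne'⟩
  suffices h : ∀ s : Finset (Fin m), ∃ x : Fin n → ℝ, (∀ i, 0 < x i) ∧
      ∀ k ∈ s, maxVec (A k) x = mu (A k) • x by
    obtain ⟨x, hx, hx'⟩ := h Finset.univ
    exact ⟨x, hx, fun k i => congrFun (hx' k (Finset.mem_univ k)) i⟩
  intro s
  induction s using Finset.induction_on with
  | empty => exact ⟨1, fun _ => one_pos, by simp⟩
  | insert l s _ ih =>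
    obtain ⟨x, hx, hxs⟩ := ih
    suffices h : ∃ z ∈ {v : Fin n → ℝ | 0 ≤ v ∧ ∀ k ∈ s, maxVec (A k) v = mu (A k) • v},
        ∃ r : ℝ, 0 ≤ r ∧ (∀ i, 0 < z i) ∧ maxVec (A l) z = r • z by
      obtain ⟨z, hz, r, hr, hzpos, hzr⟩ := h
      refine ⟨z, hzpos, fun k hk => ?_⟩
      rcases Finset.mem_insert.1 hk with rfl | hk
      · rw [mu_eq_of_maxVec_eq_smul (hA k) hzpos hr hzr, hzr]
      · exact hz.2 k hk
    refine exists_pos_eigenvector_mem (hA l) (hirr l) ?_ ?_ ?_ ?_ ⟨fun i => (hx i).le, hxs⟩ hx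
    · simp only [Set.ofPred_and, Set.ofPred_forall]
      refine isClosed_Ici.inter (isClosed_iInter fun k => isClosed_iInter fun _ => ?_)
      exact isClosed_eq (continuous_maxVec _) (continuous_const_smul _)
    · rintro v ⟨hv, hvs⟩ w ⟨hw, hws⟩
      refine ⟨hv.trans le_sup_left, fun k hk => ?_⟩
      rw [maxVec_sup (hA k), hvs k hk, hws k hk]
      ext i
      exact (mul_max_of_nonneg _ _ (mu_nonneg (hA k))).symm
    · rintro c hc v ⟨hv, hvs⟩
      refine ⟨smul_nonneg hc hv, fun k hk => ?_⟩
      rw [maxVec_smul _ hc, hvs k hk, smul_comm]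
    · rintro v ⟨hv, hvs⟩
      refine ⟨maxVec_nonneg (hA l) hv, fun k hk => ?_⟩
      rw [maxVec_maxVec (hA k) hv, hcomm, ← maxVec_maxVec (hA l) hv, hvs k hk,
        maxVec_smul _ (mu_nonneg (hA k))]

end MaxAlg
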